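/- arXiv:1405.7678 — 5 statements merged into one kernel-verified Lean document; each statement's English description precedes it below -/
import Mathlib

section
/- Let B be a commutative ring and R = B[α] a polynomial ring in one variable α, graded by the degree in α. Let d be a natural number and I ⊆ R an ideal that is homogeneous with respect to this grading (i.e., generated by elements of the form b·α^i with b ∈ B) and generated in α-degrees less than or equal to d. Let q ∈ B[α] be an element of α-degree strictly less than d such that for every b ∈ B satisfying b·α^d ∈ I one has b·q ∈ I. Then for every r ∈ R, the condition r·(α^d − q) ∈ I implies both r·α^d ∈ I and r·q ∈ I. -/
open Polynomial in
/-- If `I` is spanned by monomials of degree at most `d`, then each homogeneous component of an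
element of `I` lies in `I`, even after lowering its exponent to `d`. -/
theorem Ideal.C_coeff_mul_X_pow_min_mem_span {B : Type*} [CommRing B] {d : ℕ} {G : Set B[X]}
    (hG : ∀ g ∈ G, ∃ (b : B) (i : ℕ), i ≤ d ∧ g = C b * X ^ i)
    {f : B[X]} (hf : f ∈ Ideal.span G) (m : ℕ) :
    C (f.coeff m) * X ^ min m d ∈ Ideal.span G := by
  induction hf using Submodule.span_induction generalizing m with
  | mem g hg =>
    obtain ⟨b, i, hi, rfl⟩ := hG g hg
    rw [coeff_C_mul_X_pow]
    split_ifs with h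
    · rw [h, min_eq_left hi]
      exact Ideal.subset_span hg
    · simp
  | zero => simp
  | add x y _ _ hx hy =>
    rw [coeff_add, C_add, add_mul]
    exact add_mem (hx m) (hy m)
  | smul a x _ hx =>
    rw [smul_eq_mul, coeff_mul, map_sum, Finset.sum_mul]
    refine Submodule.sum_mem _ fun p hp => ?_
    have hle : min p.2 d ≤ min m d :=
      min_le_min_right d (Finset.HasAntidiagonal.mem_antidiagonal.mp hp ▸ Nat.le_add_left _ _)
    have hsplit : C (a.coeff p.1 * x.coeff p.2) * X ^ min m d =
        (C (a.coeff p.1) * X ^ (min m d - min p.2 d)) * (C (x.coeff p.2) * X ^ min p.2 d) := by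
      conv_lhs => rw [← Nat.sub_add_cancel hle, pow_add, C_mul]
      ring
    rw [hsplit]
    exact Ideal.mul_mem_left _ _ (hx p.2)

/-- (Remark 2.15) Let `B` be a commutative ring and `R = B[α]` the polynomial ring graded by
the degree in `α`.  Let `I ⊆ R` be an ideal which is homogeneous with respect to this grading
and generated in `α`-degrees `≤ d`, i.e. `I` is the span of a set `G` of monomials
`C b * α^i` with `i ≤ d`.  Let `q ∈ B[α]` have `α`-degree `< d` and suppose that
`C b * α^d ∈ I` implies `C b * q ∈ I` for every `b : B`.  Then for every `r ∈ R`,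
`r * (α^d - q) ∈ I` implies both `r * α^d ∈ I` and `r * q ∈ I`. -/
theorem mul_pow_mem_and_mul_mem_of_mul_sub_mem {B : Type*} [CommRing B] (d : ℕ)
    (I : Ideal (Polynomial B)) (G : Set (Polynomial B)) (hGI : I = Ideal.span G)
    (hG : ∀ g ∈ G, ∃ (b : B) (i : ℕ), i ≤ d ∧ g = Polynomial.C b * Polynomial.X ^ i)
    (q : Polynomial B) (hqdeg : q.degree < d)
    (hq : ∀ b : B, Polynomial.C b * Polynomial.X ^ d ∈ I → Polynomial.C b * q ∈ I)
    (r : Polynomial B) (hr : r * (Polynomial.X ^ d - q) ∈ I) :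
    r * Polynomial.X ^ d ∈ I ∧ r * q ∈ I := by
  have key (n : ℕ) : ∀ r : Polynomial B, r.degree < n →
      r * (Polynomial.X ^ d - q) ∈ I → r * Polynomial.X ^ d ∈ I := by
    induction n with
    | zero =>
      intro r hdeg _
      have hr0 : r = 0 := by simpa using hdeg
      simp [hr0]
    | succ n ih =>
      intro r hdeg hr
      have hlead : (r * (Polynomial.X ^ d - q)).coeff (n + d) = r.coeff n := by
        rw [Polynomial.coeff_mul_add_eq_of_natDegree_le
          (Polynomial.natDegree_le_iff_coeff_eq_zero.mpr fun m hm =>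
            (Polynomial.degree_lt_iff_coeff_zero _ _).mp hdeg m hm)
          (Polynomial.natDegree_sub_le_of_le (Polynomial.natDegree_X_pow_le d)
            (Polynomial.natDegree_le_of_degree_le hqdeg.le) |>.trans_eq (max_self d))]
        simp [Polynomial.coeff_eq_zero_of_degree_lt hqdeg]
      have hX : Polynomial.C (r.coeff n) * Polynomial.X ^ d ∈ I := by
        subst hGI
        simpa [hlead] using Ideal.C_coeff_mul_X_pow_min_mem_span hG hr (n + d)
      have hlow : (r - Polynomial.C (r.coeff n) * Polynomial.X ^ n).degree < (n : WithBot ℕ) := by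
        rw [Polynomial.degree_lt_iff_coeff_zero] at hdeg ⊢
        intro m hm
        rcases hm.eq_or_lt with rfl | hm
        · simp
        · simp [Polynomial.coeff_X_pow, hm.ne', hdeg m hm]
      have hrec := ih _ hlow <| by
        have h := sub_mem hr (I.mul_mem_left (Polynomial.X ^ n) (sub_mem hX (hq _ hX)))
        convert h using 1
        ring
      have h := add_mem hrec (I.mul_mem_left (Polynomial.X ^ n) hX)
      convert h using 1
      ring
  have hX := key (r.natDegree + 1) r
    (Polynomial.degree_le_natDegree.trans_lt (by exact_mod_cast Nat.lt_succ_self _)) hr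
  refine ⟨hX, ?_⟩
  simpa [mul_sub] using sub_mem hX hr
end

section
/- Let k be a field, S = k[α₁,…,α_n] a polynomial ring, I ⊆ S a graded (homogeneous) ideal, and A = S/I. Suppose I is m-saturated for some m ≥ 2. If H_A(m) = m+1 and H_A(m+1) = m+2, then H_A(l) = l+1 for all 1 ≤ l ≤ m; in particular H_A(1) = 2. -/
open MvPolynomial

noncomputable section

/-- The Hilbert function of a graded quotient `S/I`: `H(m) = dim_k S_m/(I ∩ S_m)`. -/
noncomputable def gradedHilb {ι k : Type*} [Field k] (I : Ideal (MvPolynomial ι k))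
    (m : ℕ) : ℕ :=
  Module.finrank k
    (↥(homogeneousSubmodule ι k m) ⧸
      (Submodule.comap (homogeneousSubmodule ι k m).subtype
        (Submodule.restrictScalars k I)))

open scoped TensorProduct

section LinearForms

variable {K : Type*} [Field K]

/-- If `f` maps onto `T`, so do all but finitely many members of the pencil `f + t g`. -/
lemma finite_setOf_range_add_smul_ne {U W : Type*} [AddCommGroup U] [Module K U]
    [AddCommGroup W] [Module K W] (f g : U →ₗ[K] W) (T : Submodule K W)
    [FiniteDimensional K T] (hf : LinearMap.range f = T) (hg : LinearMap.range g ≤ T) :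
    {t : K | LinearMap.range (f + t • g) ≠ T}.Finite := by
  let f' : U →ₗ[K] T := f.codRestrict T fun u => hf ▸ LinearMap.mem_range_self f u
  let g' : U →ₗ[K] T := g.codRestrict T fun u => hg (LinearMap.mem_range_self g u)
  have hf' : LinearMap.range f' = ⊤ := by
    rw [LinearMap.range_eq_top]
    rintro ⟨w, hw⟩
    obtain ⟨u, hu⟩ : w ∈ LinearMap.range f := hf ▸ hw
    exact ⟨u, Subtype.ext hu⟩
  obtain ⟨s, hs⟩ := f'.exists_rightInverse_of_surjective hf'
  have hfin := (Module.End.finite_hasEigenvalue (g' ∘ₗ s)).preimage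
    ((inv_injective.comp neg_injective).injOn)
  refine hfin.subset fun t ht => ?_
  by_contra hne
  refine ht (le_antisymm ?_ ?_)
  · rintro _ ⟨u, rfl⟩
    exact T.add_mem (f' u).2 (T.smul_mem t (g' u).2)
  · have hinj : Function.Injective ((f' + t • g') ∘ₗ s) := by
      rw [injective_iff_map_eq_zero]
      intro v hv
      have hv' : v + t • g' (s v) = 0 := by
        have := LinearMap.congr_fun hs v
        simp only [LinearMap.comp_apply, LinearMap.id_apply] at this
        simpa [this] using hv
      by_contra hv0
      have ht0 : t ≠ 0 := by
        rintro rfl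
        exact hv0 (by simpa using hv')
      refine hne (Module.End.hasEigenvalue_of_hasEigenvector (x := v)
        ⟨Module.End.mem_eigenspace_iff.2 ?_, hv0⟩)
      rw [Function.comp_apply, inv_neg, neg_smul, eq_neg_of_add_eq_zero_left hv', smul_neg,
        neg_neg, smul_smul, inv_mul_cancel₀ ht0, one_smul, LinearMap.comp_apply,
        ← eq_neg_of_add_eq_zero_left hv']
    intro w hw
    obtain ⟨v, hv⟩ := LinearMap.surjective_of_injective hinj ⟨w, hw⟩
    exact ⟨s v, congrArg Subtype.val hv⟩

/-- Multiplication by `a` on a submodule `U`. -/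
def mulLeftOn {R : Type*} [CommRing R] [Algebra K R] (U : Submodule K R) (a : R) : U →ₗ[K] R :=
  (LinearMap.mulLeft K a).domRestrict U

variable {R : Type*} [CommRing R] [Algebra K R]

lemma range_mulLeftOn (U : Submodule K R) (a : R) :
    LinearMap.range (mulLeftOn U a) = Submodule.span K {a} * U := by
  ext x
  simp [mulLeftOn, Submodule.mem_span_singleton_mul]

lemma span_singleton_mul_le {V : Submodule K R} (U : Submodule K R) {a : R} (ha : a ∈ V) :
    Submodule.span K {a} * U ≤ V * U :=
  mul_le_mul_left ((Submodule.span_singleton_le_iff_mem _ _).2 ha) U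

lemma exists_common_span_singleton_mul_eq [Infinite K] {V U₁ U₂ : Submodule K R} (hV : V.FG)
    (hU₁ : U₁.FG) (hU₂ : U₂.FG) {a b : R} (ha : a ∈ V) (hb : b ∈ V)
    (h₁ : Submodule.span K {a} * U₁ = V * U₁) (h₂ : Submodule.span K {b} * U₂ = V * U₂) :
    ∃ c ∈ V, Submodule.span K {c} * U₁ = V * U₁ ∧ Submodule.span K {c} * U₂ = V * U₂ := by
  have : FiniteDimensional K ↥(V * U₁) := .of_fg (hV.mul hU₁)
  have : FiniteDimensional K ↥(V * U₂) := .of_fg (hV.mul hU₂)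
  have F₁ := finite_setOf_range_add_smul_ne (mulLeftOn U₁ a) (mulLeftOn U₁ b) (V * U₁)
    (by rw [range_mulLeftOn, h₁]) (by rw [range_mulLeftOn]; exact span_singleton_mul_le _ hb)
  have F₂ := finite_setOf_range_add_smul_ne (mulLeftOn U₂ b) (mulLeftOn U₂ a) (V * U₂)
    (by rw [range_mulLeftOn, h₂]) (by rw [range_mulLeftOn]; exact span_singleton_mul_le _ ha)
  obtain ⟨t, ht⟩ := ((F₁.union (F₂.preimage inv_injective.injOn)).union
    (Set.finite_singleton 0)).exists_notMem
  simp only [Set.mem_union, Set.mem_preimage, Set.mem_ofPred_eq, Set.mem_singleton_iff, not_or,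
    not_not] at ht
  obtain ⟨⟨ht₁, ht₂⟩, ht₀⟩ := ht
  refine ⟨a + t • b, V.add_mem ha (V.smul_mem t hb), ?_, ?_⟩
  · rw [← ht₁, ← range_mulLeftOn]
    congr 1
    ext x
    simp [mulLeftOn, add_mul]
  · have : Submodule.span K {a + t • b} = Submodule.span K {b + t⁻¹ • a} := by
      have e : a + t • b = t • (b + t⁻¹ • a) := by
        rw [smul_add, smul_smul, mul_inv_cancel₀ ht₀, one_smul, add_comm]
      rw [e, Submodule.span_singleton_smul_eq (IsUnit.mk0 t ht₀)]
    rw [this, ← ht₂, ← range_mulLeftOn]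
    congr 1
    ext x
    simp [mulLeftOn, add_mul]

/-- If every element of `V` has rank at most `e` as a map `V ^ e * N → V ^ (e + 1) * N`, then some
element of `V` is surjective there. -/
lemma exists_span_singleton_mul_eq [Infinite K] {V : Submodule K R} (hV : V.FG) (e : ℕ) :
    ∀ N : Submodule K R, N.FG →
      (∀ h ∈ V, Module.finrank K ↥(Submodule.span K {h} * (V ^ e * N)) ≤ e) →
      ∃ h ∈ V, Submodule.span K {h} * (V ^ e * N) = V * (V ^ e * N) := by
  induction e with
  | zero =>
    intro N hN H
    refine ⟨0, V.zero_mem, le_antisymm (span_singleton_mul_le _ V.zero_mem) ?_⟩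
    rw [Submodule.mul_le]
    intro v hv u hu
    have : FiniteDimensional K ↥(Submodule.span K {v} * (V ^ 0 * N)) :=
      .of_fg ((Submodule.fg_span_singleton v).mul ((hV.pow 0).mul hN))
    have h0 := Submodule.finrank_eq_zero.1 (Nat.le_zero.1 (H v hv))
    have : v * u ∈ Submodule.span K {v} * (V ^ 0 * N) :=
      Submodule.mul_mem_mul (Submodule.mem_span_singleton_self v) hu
    rw [h0, Submodule.mem_bot] at this
    rw [this]
    exact zero_mem _
  | succ e ih =>
    intro N hN H
    let U : Submodule K R := V ^ (e + 1) * N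
    have hU : U = V ^ (e + 1) * N := rfl
    have hUfg : U.FG := (hV.pow _).mul hN
    have fd (h : R) : FiniteDimensional K ↥(Submodule.span K {h} * U) :=
      .of_fg ((Submodule.fg_span_singleton h).mul hUfg)
    have comm (h : R) : V * (V ^ e * (Submodule.span K {h} * N)) = Submodule.span K {h} * U := by
      rw [hU, pow_succ]; ring
    have fg' (h : R) : (V ^ e * (Submodule.span K {h} * N)).FG :=
      (hV.pow e).mul ((Submodule.fg_span_singleton h).mul hN)
    have claim : ∀ h ∈ V, ∃ h' ∈ V, Submodule.span K {h'} * (V ^ e * (Submodule.span K {h} * N)) =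
        V * (V ^ e * (Submodule.span K {h} * N)) := by
      intro h hh
      by_cases hc : ∀ h' ∈ V,
          Module.finrank K ↥(Submodule.span K {h'} * (V ^ e * (Submodule.span K {h} * N))) ≤ e
      · exact ih _ ((Submodule.fg_span_singleton h).mul hN) hc
      · push Not at hc
        obtain ⟨h', hh', hlt⟩ := hc
        have := fd h
        rw [← comm h] at this
        refine ⟨h', hh', Submodule.eq_of_le_of_finrank_le (span_singleton_mul_le _ hh') ?_⟩
        have := H h hh
        rw [← comm h] at this
        omega
    obtain ⟨h, hh, hmax⟩ : ∃ h ∈ V, ∀ g ∈ V, Module.finrank K ↥(Submodule.span K {g} * U) ≤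
        Module.finrank K ↥(Submodule.span K {h} * U) := by
      let s := Set.image (fun h : R => Module.finrank K ↥(Submodule.span K {h} * U)) V
      have hs : BddAbove s := ⟨e + 1, by rintro _ ⟨h, hh, rfl⟩; exact H h hh⟩
      obtain ⟨h, hh, he⟩ := Nat.sSup_mem (s := s) ⟨_, 0, V.zero_mem, rfl⟩ hs
      exact ⟨h, hh, fun g hg => (le_csSup hs ⟨g, hg, rfl⟩).trans_eq he.symm⟩
    refine ⟨h, hh, le_antisymm (span_singleton_mul_le _ hh) ?_⟩
    rw [Submodule.mul_le]
    intro g hg u hu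
    obtain ⟨a, ha, ha'⟩ := claim h hh
    obtain ⟨b, hb, hb'⟩ := claim g hg
    obtain ⟨c, hc, hc₁, hc₂⟩ :=
      exists_common_span_singleton_mul_eq hV (fg' h) (fg' g) ha hb ha' hb'
    have sub : ∀ x ∈ V, V ^ e * (Submodule.span K {x} * N) ≤ U := by
      intro x hx
      have := mul_le_mul_right (span_singleton_mul_le N hx) (V ^ e)
      rwa [← mul_assoc (V ^ e) V N, ← pow_succ] at this
    have le (x : R) (hx : x ∈ V) (hcx : Submodule.span K {c} *
        (V ^ e * (Submodule.span K {x} * N)) = V * (V ^ e * (Submodule.span K {x} * N))) :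
        Submodule.span K {x} * U ≤ Submodule.span K {c} * U := by
      rw [← comm x, ← hcx]
      exact mul_le_mul_right (sub x hx) _
    have heq := Submodule.eq_of_le_of_finrank_le (le h hh hc₁) (hmax c hc)
    rw [heq]
    exact le g hg hc₂ (Submodule.mul_mem_mul (Submodule.mem_span_singleton_self g) hu)

/-- The statement for the graded algebra generated by `V`, over an infinite field. -/
lemma finrank_pow_eq_of_infinite [Infinite K] {V : Submodule K R} (hV : V.FG) {m : ℕ}
    (hsat : ∀ l ≤ m, ∀ σ ∈ V ^ l, (∀ τ ∈ V ^ (m - l), τ * σ = 0) → σ = 0)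
    (hm : Module.finrank K ↥(V ^ m) = m + 1) (hm' : Module.finrank K ↥(V ^ (m + 1)) = m + 2)
    {l : ℕ} (hl : l ≤ m) : Module.finrank K ↥(V ^ l) = l + 1 := by
  have fd (l : ℕ) : FiniteDimensional K ↥(V ^ l) := .of_fg (hV.pow l)
  obtain ⟨h, hh, hlt⟩ : ∃ h ∈ V, m < Module.finrank K ↥(Submodule.span K {h} * V ^ m) := by
    by_contra! H
    obtain ⟨h, hh, he⟩ := exists_span_singleton_mul_eq hV m 1 (hV.pow 0) fun h hh => by
      rw [mul_one]
      exact H h hh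
    have := H h hh
    rw [mul_one] at he
    rw [he, ← pow_succ', hm'] at this
    omega
  have inj {l : ℕ} (hl : l ≤ m) {σ : R} (hσ : σ ∈ V ^ l) (h0 : h * σ = 0) : σ = 0 := by
    have hinj : Function.Injective (mulLeftOn (V ^ m) h) := by
      rw [← LinearMap.ker_eq_bot, ← Submodule.finrank_eq_zero]
      have := (mulLeftOn (V ^ m) h).finrank_range_add_finrank_ker
      rw [range_mulLeftOn, hm] at this
      omega
    refine hsat l hl σ hσ fun τ hτ => ?_
    have hmem : τ * σ ∈ V ^ m := by
      have := Submodule.mul_mem_mul hτ hσ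
      rwa [← pow_add, Nat.sub_add_cancel hl] at this
    have := @hinj ⟨τ * σ, hmem⟩ 0 (by simp [mulLeftOn, mul_left_comm h τ σ, h0])
    simpa using congrArg Subtype.val this
  have step {l : ℕ} (hl : l ≤ m) :
      Module.finrank K ↥(V ^ l) < Module.finrank K ↥(V ^ (l + 1)) := by
    have hle : Submodule.span K {h} * V ^ l ≤ V ^ (l + 1) := by
      rw [pow_succ']; exact span_singleton_mul_le _ hh
    have hr : Module.finrank K ↥(Submodule.span K {h} * V ^ l) = Module.finrank K ↥(V ^ l) := by
      rw [← range_mulLeftOn]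
      refine LinearMap.finrank_range_of_inj ((injective_iff_map_eq_zero _).2 fun σ hσ => ?_)
      exact Subtype.ext (inj hl σ.2 hσ)
    by_contra! H
    have heq := Submodule.eq_of_le_of_finrank_le hle (hr ▸ H)
    have : Submodule.span K {h} * V ^ m = V ^ (m + 1) := by
      calc _ = V ^ (m - l) * (Submodule.span K {h} * V ^ l) := by
            rw [mul_left_comm, ← pow_add, Nat.sub_add_cancel hl]
        _ = _ := by rw [heq, ← pow_add]; congr 1; omega
    have hfin := (mulLeftOn (V ^ m) h).finrank_range_le
    rw [range_mulLeftOn, this, hm, hm'] at hfin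
    omega
  have lower : ∀ j ≤ m, j + 1 ≤ Module.finrank K ↥(V ^ j) := by
    intro j
    induction j with
    | zero =>
      intro _
      rw [Nat.succ_le_iff, Nat.pos_iff_ne_zero, Ne, Submodule.finrank_eq_zero]
      intro h0
      rw [← Nat.zero_add m, pow_add, h0, Submodule.bot_mul, finrank_bot] at hm
      omega
    | succ j ih =>
      intro hj
      have := ih (by omega)
      have := step (l := j) (by omega)
      omega
  have upper : ∀ j, l + j ≤ m →
      Module.finrank K ↥(V ^ l) + j ≤ Module.finrank K ↥(V ^ (l + j)) := by
    intro j
    induction j with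
    | zero => simp
    | succ j ih =>
      intro hj
      have := ih (by omega)
      have := step (l := l + j) (by omega)
      rw [← add_assoc, ← add_assoc]
      omega
  have h₁ := lower l hl
  have h₂ := upper (m - l) (by omega)
  rw [Nat.add_sub_cancel' hl, hm] at h₂
  omega

end LinearForms

section BaseChange

variable {k R : Type*} [Field k] [CommRing R] [Algebra k R] (K : Type*) [Field K] [Algebra k K]

open scoped Pointwise in
lemma baseChange_pow_eq (V : Submodule k R) (l : ℕ) :
    V.baseChange K ^ l = (V ^ l).baseChange K := by
  have : (V ^ l).baseChange K = (Submodule.span k ((V : Set R) ^ l)).baseChange K := by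
    rw [← Submodule.span_pow, Submodule.span_eq]
  rw [this, Submodule.baseChange_span, Submodule.baseChange_eq_span, Submodule.span_pow]
  congr 1
  exact (Set.image_pow (Algebra.TensorProduct.includeRight : R →ₐ[k] K ⊗[k] R) (V : Set R) l).symm

lemma finrank_submodule_baseChange (P : Submodule k R) :
    Module.finrank K ↥(P.baseChange K) = Module.finrank k P := by
  rw [Submodule.baseChange, LinearMap.finrank_range_of_inj, Module.finrank_baseChange]
  exact Module.Flat.lTensor_preserves_injective_linearMap (M := K) _ P.injective_subtype

lemma eq_zero_of_mem_baseChange {P Q : Submodule k R}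
    (h : ∀ σ ∈ P, (∀ τ ∈ Q, τ * σ = 0) → σ = 0) {σ : K ⊗[k] R} (hσ : σ ∈ P.baseChange K)
    (h0 : ∀ τ ∈ Q.baseChange K, τ * σ = 0) : σ = 0 := by
  obtain ⟨x, rfl⟩ := P.toBaseChange_surjective' K hσ
  let b := Module.Free.chooseBasis k K
  obtain ⟨c, rfl⟩ := TensorProduct.eq_repr_basis_left b x
  have hc : c = 0 := by
    ext i
    refine h _ (c i).2 fun τ hτ => ?_
    have key := h0 _ (Submodule.tmul_mem_baseChange_of_mem (1 : K) hτ)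
    have := TensorProduct.sum_tmul_basis_left_eq_zero b
      (Finsupp.mapRange.linearMap ((LinearMap.mulLeft k τ).domRestrict P) c) (by
        rw [← key, Finsupp.mapRange.linearMap_apply, Finsupp.sum_mapRange_index (by simp)]
        simp [Finsupp.sum, map_sum, Finset.mul_sum])
    simpa using DFunLike.congr_fun this i
  simp [hc]

/-- The statement for the graded algebra generated by `V`, over any field. -/
lemma finrank_pow_eq {V : Submodule k R} (hV : V.FG) {m : ℕ}
    (hsat : ∀ l ≤ m, ∀ σ ∈ V ^ l, (∀ τ ∈ V ^ (m - l), τ * σ = 0) → σ = 0)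
    (hm : Module.finrank k ↥(V ^ m) = m + 1) (hm' : Module.finrank k ↥(V ^ (m + 1)) = m + 2)
    {l : ℕ} (hl : l ≤ m) : Module.finrank k ↥(V ^ l) = l + 1 := by
  let K := AlgebraicClosure k
  have hr (j : ℕ) : Module.finrank K ↥(V.baseChange K ^ j) = Module.finrank k ↥(V ^ j) := by
    rw [baseChange_pow_eq, finrank_submodule_baseChange]
  have hfg : (V.baseChange K).FG := by
    obtain ⟨s, rfl⟩ := hV
    classical
    rw [Submodule.baseChange_span, ← Finset.coe_image]
    exact ⟨_, rfl⟩
  rw [← hr] at hm hm' ⊢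
  refine finrank_pow_eq_of_infinite hfg (fun j hj σ hσ h0 => ?_) hm hm' hl
  rw [baseChange_pow_eq] at hσ h0
  exact eq_zero_of_mem_baseChange K (hsat j hj) hσ h0

end BaseChange

lemma gradedHilb_eq_finrank_pow {ι k : Type*} [Field k] (I : Ideal (MvPolynomial ι k)) (l : ℕ) :
    gradedHilb I l = Module.finrank k
      ↥((homogeneousSubmodule ι k 1).map (Ideal.Quotient.mkₐ k I).toLinearMap ^ l) := by
  rw [← Submodule.map_pow, homogeneousSubmodule_one_pow, gradedHilb]
  let f := (Ideal.Quotient.mkₐ k I).toLinearMap ∘ₗ (homogeneousSubmodule ι k l).subtype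
  have hker : Submodule.comap (homogeneousSubmodule ι k l).subtype
      (Submodule.restrictScalars k I) = LinearMap.ker f := by
    ext x
    simp [f, Ideal.Quotient.eq_zero_iff_mem]
  have hrange : (homogeneousSubmodule ι k l).map (Ideal.Quotient.mkₐ k I).toLinearMap =
      LinearMap.range f := by
    rw [LinearMap.range_comp, Submodule.range_subtype]
  rw [hker, hrange]
  exact f.quotKerEquivRange.finrank_eq

/-- (Lemma 2.9(1)) Let `S = k[α₁,…,α_n]`, `I ⊆ S` a homogeneous ideal and `A = S/I`,
with Hilbert function `H_A(m) = dim_k S_m/(I ∩ S_m)`.  Suppose `I` is `m`-saturated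
for some `m ≥ 2`.  If `H_A(m) = m + 1` and `H_A(m+1) = m + 2`, then `H_A(l) = l + 1`
for all `1 ≤ l ≤ m`; in particular `H_A(1) = 2`. -/
theorem gradedHilb_eq_of_m_saturated_of_add_one {n : ℕ} {k : Type*} [Field k]
    (I : Ideal (MvPolynomial (Fin n) k))
    (hhom : ∀ p ∈ I, ∀ e : ℕ, homogeneousComponent e p ∈ I)
    (m : ℕ) (hm : 2 ≤ m)
    (hsat : ∀ l ≤ m, ∀ σ : MvPolynomial (Fin n) k, σ.IsHomogeneous l →
      (∀ τ ∈ (Ideal.span (Set.range (X : Fin n → MvPolynomial (Fin n) k))) ^ (m - l),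
        σ * τ ∈ I) → σ ∈ I)
    (hHm : gradedHilb I m = m + 1) (hHm1 : gradedHilb I (m + 1) = m + 2) :
    ∀ l, 1 ≤ l → l ≤ m → gradedHilb I l = l + 1 := by
  intro l _ hl
  simp only [gradedHilb_eq_finrank_pow] at hHm hHm1 ⊢
  refine finrank_pow_eq ((homogeneousSubmodule_fg (Fin n) k 1).map _)
    (fun j hj σ hσ h0 => ?_) hHm hHm1 hl
  simp only [← Submodule.map_pow, homogeneousSubmodule_one_pow] at hσ h0
  obtain ⟨p, hp, rfl⟩ := hσ
  refine Ideal.Quotient.eq_zero_iff_mem.2 (hsat j hj p hp fun τ hτ => ?_)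
  rw [Ideal.span, Submodule.span_pow] at hτ
  induction hτ using Submodule.span_induction with
  | mem τ hτ =>
    have hτ' : τ ∈ homogeneousSubmodule (Fin n) k (m - j) := by
      rw [← homogeneousSubmodule_one_pow, homogeneousSubmodule_one_eq_span_X, Submodule.span_pow]
      exact Submodule.subset_span hτ
    have := h0 _ (Submodule.mem_map_of_mem hτ')
    rw [mul_comm]
    exact Ideal.Quotient.eq_zero_iff_mem.1 ((map_mul _ _ _).trans this)
  | zero => simp
  | add x y _ _ hx hy => rw [mul_add]; exact I.add_mem hx hy
  | smul a x _ hx => rw [smul_eq_mul, mul_left_comm]; exact I.mul_mem_left a hx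
end
end

section
/- Let k be a field, S = k[α₁,…,α_n] a polynomial ring, I ⊆ S a graded (homogeneous) ideal, and A = S/I. Suppose I is m-saturated for some m ≥ 2. If H_A(m) = m+2 and H_A(m+1) = m+3, then H_A(l) = l+2 for all 1 ≤ l ≤ m; in particular H_A(1) = 3. -/
open MvPolynomial

noncomputable section

section GradedPiece

variable {k M ι : Type*} [Field k] [AddCommGroup M] [Module k M]

/-- The subspace spanned by all products of `d` of the operators `x i` applied to `F`. -/
def gradedPiece (x : ι → Module.End k M) (F : Submodule k M) : ℕ → Submodule k M
  | 0 => F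
  | d + 1 => ⨆ i, (gradedPiece x F d).map (x i)

variable {x : ι → Module.End k M} {F : Submodule k M}

theorem map_gradedPiece_le {f : Module.End k M} (hf : f ∈ Submodule.span k (Set.range x))
    (d : ℕ) : (gradedPiece x F d).map f ≤ gradedPiece x F (d + 1) := by
  rintro _ ⟨v, hv, rfl⟩
  induction hf using Submodule.span_induction with
  | mem f hf =>
    obtain ⟨i, rfl⟩ := hf
    exact Submodule.mem_iSup_of_mem i (Submodule.mem_map_of_mem hv)
  | zero => simp
  | add f g _ _ hf hg => exact add_mem hf hg
  | smul c f _ hf => exact Submodule.smul_mem _ c hf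

theorem commute_of_mem_span (hx : ∀ i j, Commute (x i) (x j)) {f g : Module.End k M}
    (hf : f ∈ Submodule.span k (Set.range x)) (hg : g ∈ Submodule.span k (Set.range x)) :
    Commute f g := by
  induction hf using Submodule.span_induction with
  | mem f hf =>
    obtain ⟨i, rfl⟩ := hf
    induction hg using Submodule.span_induction with
    | mem g hg => obtain ⟨j, rfl⟩ := hg; exact hx i j
    | zero => exact Commute.zero_right _
    | add f g _ _ hf hg => exact hf.add_right hg
    | smul c f _ hf => exact hf.smul_right c
  | zero => exact Commute.zero_left _
  | add f g _ _ hf hg => exact hf.add_left hg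
  | smul c f _ hf => exact hf.smul_left c

theorem gradedPiece_map {f : Module.End k M} (hf : ∀ i, Commute f (x i)) (d : ℕ) :
    gradedPiece x (F.map f) d = (gradedPiece x F d).map f := by
  induction d with
  | zero => rfl
  | succ d ih =>
    simp only [gradedPiece, ih, Submodule.map_iSup, ← Submodule.map_comp]
    refine iSup_congr fun i => ?_
    congr 1
    exact (hf i).symm.eq

theorem finiteDimensional_gradedPiece [Finite ι] [FiniteDimensional k F] (d : ℕ) :
    FiniteDimensional k (gradedPiece x F d) := by
  induction d with
  | zero => assumption
  | succ d ih => exact Submodule.finite_iSup _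

theorem finrank_map_add_finrank_inf_ker {Q : Type*} [AddCommGroup Q] [Module k Q]
    (N : Submodule k M) [FiniteDimensional k N] (g : M →ₗ[k] Q) :
    Module.finrank k (N.map g) + Module.finrank k (N ⊓ LinearMap.ker g : Submodule k M) =
      Module.finrank k N := by
  have h := LinearMap.finrank_range_add_finrank_ker (g.domRestrict N)
  rw [LinearMap.range_domRestrict, LinearMap.ker_domRestrict] at h
  rw [← h, ← Submodule.map_comap_subtype,
    Submodule.finrank_map_subtype_eq]

/-- The rank is lower semicontinuous along a pencil of linear maps. -/
theorem finite_setOf_finrank_range_add_smul_lt {E Q : Type*} [AddCommGroup E] [Module k E]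
    [FiniteDimensional k E] [AddCommGroup Q] [Module k Q] (φ ψ : E →ₗ[k] Q) :
    {c : k | Module.finrank k (LinearMap.range (φ + c • ψ)) <
      Module.finrank k (LinearMap.range φ)}.Finite := by
  obtain ⟨s, hs⟩ := φ.rangeRestrict.exists_rightInverse_of_surjective φ.range_rangeRestrict
  obtain ⟨p, hp⟩ := (LinearMap.range φ).subtype.exists_leftInverse_of_injective
    (LinearMap.range φ).ker_subtype
  let T : Module.End k (LinearMap.range φ) := p ∘ₗ ψ ∘ₗ s
  have key : ∀ (c : k) (v), p ((φ + c • ψ) (s v)) = v + c • T v := by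
    intro c v
    have h1 : φ (s v) = (LinearMap.range φ).subtype v :=
      congrArg Subtype.val (LinearMap.congr_fun hs v)
    have h2 : p ((LinearMap.range φ).subtype v) = v := LinearMap.congr_fun hp v
    simp only [LinearMap.add_apply, LinearMap.smul_apply, map_add, map_smul, h1, h2]
    rfl
  refine ((Module.End.finite_hasEigenvalue T).image fun μ => -μ⁻¹).subset ?_
  intro c hc
  by_contra hn
  refine absurd (Set.mem_ofPred_eq ▸ hc) (not_lt.mpr ?_)
  have hinj : Function.Injective ((φ + c • ψ) ∘ₗ s) := by
    rw [injective_iff_map_eq_zero]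
    intro v hv
    by_contra hv0
    have h := key c v
    rw [show (φ + c • ψ) (s v) = 0 from hv, map_zero] at h
    have hc0 : c ≠ 0 := by
      rintro rfl
      exact hv0 (by simpa using h.symm)
    refine hn ⟨-c⁻¹, ?_, by simp⟩
    refine Module.End.hasEigenvalue_of_hasEigenvector (x := v)
      ⟨Module.End.mem_eigenspace_iff.mpr ?_, hv0⟩
    have h' : c • T v = -v := by
      rw [eq_neg_iff_add_eq_zero, add_comm]; exact h.symm
    rw [neg_smul, ← smul_neg, ← h', smul_smul, inv_mul_cancel₀ hc0, one_smul]
  rw [← LinearMap.finrank_range_of_inj hinj]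
  exact Submodule.finrank_mono (LinearMap.range_comp_le_range _ _)

theorem finite_setOf_finrank_map_add_smul_lt {Q : Type*} [AddCommGroup Q] [Module k Q]
    (N : Submodule k M) [FiniteDimensional k N] (φ ψ : M →ₗ[k] Q) :
    {c : k | Module.finrank k (N.map (φ + c • ψ)) < Module.finrank k (N.map φ)}.Finite := by
  have e : ∀ c : k, N.map (φ + c • ψ) =
      LinearMap.range (φ.domRestrict N + c • ψ.domRestrict N) :=
    fun c => (LinearMap.range_domRestrict _ _).symm
  have h := finite_setOf_finrank_range_add_smul_lt (φ.domRestrict N) (ψ.domRestrict N)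
  refine h.subset fun c hc => ?_
  rw [Set.mem_ofPred_eq, e, ← LinearMap.range_domRestrict N φ] at hc
  exact hc

theorem exists_smul_eq_of_finrank_map_le_one {Q : Type*} [AddCommGroup Q] [Module k Q]
    {N : Submodule k M} [FiniteDimensional k N] {g : M →ₗ[k] Q}
    (h : Module.finrank k (N.map g) ≤ 1) {a b : M} (ha : a ∈ N) (hb : b ∈ N) (h0 : g a ≠ 0) :
    ∃ c : k, g b = c • g a := by
  obtain ⟨v, hv⟩ := finrank_le_one_iff.mp h
  obtain ⟨α, hα⟩ := hv ⟨g a, Submodule.mem_map_of_mem ha⟩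
  obtain ⟨β, hβ⟩ := hv ⟨g b, Submodule.mem_map_of_mem hb⟩
  have hα' : α • (v : Q) = g a := congrArg Subtype.val hα
  have hβ' : β • (v : Q) = g b := congrArg Subtype.val hβ
  have hα0 : α ≠ 0 := by
    rintro rfl
    exact h0 (by rw [← hα', zero_smul])
  exact ⟨β * α⁻¹, by rw [← hα', ← hβ', smul_smul, inv_mul_cancel_right₀ hα0]⟩

/-- If every linear form acts with rank at most one between two consecutive pieces, modulo the
kernel of `g`, then the target piece has dimension at most one modulo the kernel of `g`. -/
theorem finrank_map_gradedPiece_le_one [Finite ι] [FiniteDimensional k F]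
    (hx : ∀ i j, Commute (x i) (x j)) {Q : Type*} [AddCommGroup Q] [Module k Q]
    (g : M →ₗ[k] Q) (d : ℕ)
    (h : ∀ f ∈ Submodule.span k (Set.range x),
      Module.finrank k ((gradedPiece x F (d + 1)).map (g ∘ₗ f)) ≤ 1) :
    Module.finrank k ((gradedPiece x F (d + 2)).map g) ≤ 1 := by
  have := finiteDimensional_gradedPiece (x := x) (F := F) (d + 1)
  have hmem : ∀ i, x i ∈ Submodule.span k (Set.range x) :=
    fun i => Submodule.subset_span ⟨i, rfl⟩
  have dep : ∀ f ∈ Submodule.span k (Set.range x), ∀ a ∈ gradedPiece x F (d + 1),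
      ∀ b ∈ gradedPiece x F (d + 1), g (f a) ≠ 0 → ∃ c : k, g (f b) = c • g (f a) :=
    fun f hf a ha b hb h0 => exists_smul_eq_of_finrank_map_le_one (h f hf) ha hb h0
  have hle : ∀ q : Q, (∀ i, ∀ a ∈ gradedPiece x F (d + 1), g (x i a) ∈ Submodule.span k {q}) →
      Module.finrank k ((gradedPiece x F (d + 2)).map g) ≤ 1 := by
    intro q hq
    refine (Submodule.finrank_mono (t := Submodule.span k {q}) ?_).trans
      ((finrank_span_le_card _).trans (by simp))
    rw [Submodule.map_le_iff_le_comap]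
    refine iSup_le fun i => ?_
    rintro _ ⟨a, ha, rfl⟩
    exact hq i a ha
  by_cases hall : ∀ i, ∀ a ∈ gradedPiece x F (d + 1), g (x i a) = 0
  · exact hle 0 fun i a ha => by simp [hall i a ha]
  push Not at hall
  obtain ⟨i, a, ha, hia⟩ := hall
  refine hle (g (x i a)) fun j b hb => ?_
  by_contra hjb
  have hind : ∀ α β : k, α • g (x i a) + β • g (x j b) = 0 → β = 0 := by
    intro α β hαβ
    by_contra hβ
    refine hjb (Submodule.mem_span_singleton.mpr ⟨-(β⁻¹ * α), ?_⟩)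
    have : β • g (x j b) = -(α • g (x i a)) := by
      rw [eq_neg_iff_add_eq_zero, add_comm]; exact hαβ
    rw [neg_smul, mul_smul, ← smul_neg, ← this, smul_smul, inv_mul_cancel₀ hβ, one_smul]
  have hjb0 : g (x j b) ≠ 0 := fun h0 => hjb (h0 ▸ zero_mem _)
  have hker : ∀ v ∈ gradedPiece x F (d + 1), g (x i v) ≠ 0 → g (x j v) ≠ 0 := by
    intro v hv hiv hjv
    obtain ⟨c, hc⟩ := dep _ (hmem i) a ha v hv hia
    have hc0 : c ≠ 0 := by
      rintro rfl
      exact hiv (by rw [hc, zero_smul])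
    obtain ⟨e, he⟩ := dep _ (hmem i) a ha b hb hia
    obtain ⟨t, ht⟩ := dep _ (add_mem (hmem i) (hmem j)) v hv b hb
      (by simpa [hjv] using hiv)
    simp only [LinearMap.add_apply, map_add, hjv, hc, he, add_zero] at ht
    refine one_ne_zero (hind (e - t * c) 1 ?_)
    rw [sub_smul, one_smul, mul_smul, ← ht]
    abel
  obtain ⟨z, w, hw, hzw⟩ : ∃ z, ∃ w ∈ gradedPiece x F d, g (x i (x z w)) ≠ 0 := by
    by_contra! hcon
    refine hia ?_
    have : gradedPiece x F (d + 1) ≤ LinearMap.ker (g ∘ₗ x i) := by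
      refine iSup_le fun z => ?_
      rintro _ ⟨w, hw, rfl⟩
      exact hcon z w hw
    exact this ha
  have hmemw : ∀ z, x z w ∈ gradedPiece x F (d + 1) := fun z =>
    map_gradedPiece_le (hmem z) d (Submodule.mem_map_of_mem hw)
  have hjzw := hker _ (hmemw z) hzw
  have hcomm : ∀ p q v, x p (x q v) = x q (x p v) := fun p q v =>
    LinearMap.congr_fun (hx p q).eq v
  obtain ⟨c, hc⟩ := dep _ (hmem i) a ha _ (hmemw z) hia
  obtain ⟨e, he⟩ := dep _ (hmem j) b hb _ (hmemw z) hjb0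
  obtain ⟨t, ht⟩ := dep _ (hmem z) _ (hmemw i) _ (hmemw j) (by rwa [hcomm z i])
  rw [hcomm z j, hcomm z i, hc, he] at ht
  have he0 := hind (t * c) (-e) (by rw [neg_smul, ht, smul_smul]; abel)
  exact hjzw (by rw [he, neg_eq_zero.mp he0, zero_smul])

/-- A case of Green's hyperplane restriction theorem. -/
theorem exists_finrank_gradedPiece_le_finrank_map_add_one [Infinite k] [Finite ι]
    (hx : ∀ i j, Commute (x i) (x j)) (d : ℕ) (F : Submodule k M) [FiniteDimensional k F]
    (hd : Module.finrank k (gradedPiece x F (d + 1)) ≤ 2 * (d + 1)) :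
    ∃ h ∈ Submodule.span k (Set.range x), Module.finrank k (gradedPiece x F (d + 1)) ≤
      Module.finrank k ((gradedPiece x F d).map h) + 1 := by
  induction d generalizing F with
  | zero =>
    by_cases h0 : ∀ i, F.map (x i) = ⊥
    · refine ⟨0, zero_mem _, ?_⟩
      have : gradedPiece x F (0 + 1) = ⊥ := iSup_eq_bot.mpr h0
      rw [this, finrank_bot]
      exact Nat.zero_le _
    · push Not at h0
      obtain ⟨i, hi⟩ := h0
      refine ⟨x i, Submodule.subset_span ⟨i, rfl⟩, ?_⟩
      have := Submodule.one_le_finrank_iff.mpr hi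
      have e : gradedPiece x F 0 = F := rfl
      rw [e]
      omega
  | succ d ih =>
    have hfin := fun j => finiteDimensional_gradedPiece (x := x) (F := F) j
    have hbdd : BddAbove ((fun f => Module.finrank k ((gradedPiece x F (d + 1)).map f)) ''
        (Submodule.span k (Set.range x) : Set (Module.End k M))) := by
      refine ⟨Module.finrank k (gradedPiece x F (d + 1)), ?_⟩
      rintro _ ⟨f, -, rfl⟩
      exact Submodule.finrank_map_le f _
    obtain ⟨h, hh, hmax⟩ := Nat.sSup_mem (Set.Nonempty.image _ ⟨0, zero_mem _⟩) hbdd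
    replace hmax : ∀ f ∈ Submodule.span k (Set.range x),
        Module.finrank k ((gradedPiece x F (d + 1)).map f) ≤
          Module.finrank k ((gradedPiece x F (d + 1)).map h) :=
      fun f hf => (le_csSup hbdd (Set.mem_image_of_mem _ hf)).trans_eq hmax.symm
    refine ⟨h, hh, ?_⟩
    by_contra! hlt
    have hpiece := gradedPiece_map (F := F)
      fun i => commute_of_mem_span hx hh (Submodule.subset_span ⟨i, rfl⟩)
    obtain ⟨h', hh', hr⟩ := ih (F.map h) (by rw [hpiece]; omega)
    rw [hpiece, hpiece] at hr
    have hone := finrank_map_gradedPiece_le_one (F := F) hx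
      ((gradedPiece x F (d + 1)).map h).mkQ d ?_
    · have e := finrank_map_add_finrank_inf_ker (gradedPiece x F (d + 2))
        ((gradedPiece x F (d + 1)).map h).mkQ
      rw [Submodule.ker_mkQ, inf_eq_right.mpr (map_gradedPiece_le hh _)] at e
      change _ < Module.finrank k (gradedPiece x F (d + 2)) at hlt
      omega
    intro f hf
    by_contra! hrank
    set g := ((gradedPiece x F (d + 1)).map h).mkQ with hg
    have hbad1 := finite_setOf_finrank_map_add_smul_lt (gradedPiece x F (d + 1))
      (g ∘ₗ f) (g ∘ₗ h')
    have hbad2 := finite_setOf_finrank_map_add_smul_lt ((gradedPiece x F d).map h) h' f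
    obtain ⟨c, hc⟩ :=
      ((hbad1.union (hbad2.preimage inv_injective.injOn)).insert 0).infinite_compl.nonempty
    simp only [Set.mem_compl_iff, Set.mem_insert_iff, Set.mem_union, Set.mem_preimage,
      Set.mem_ofPred_eq, not_or, not_lt] at hc
    obtain ⟨hc0, hc1, hc2⟩ := hc
    have hmem : f + c • h' ∈ Submodule.span k (Set.range x) :=
      add_mem hf (Submodule.smul_mem _ c hh')
    have hscale : ((gradedPiece x F d).map h).map (h' + c⁻¹ • f) =
        ((gradedPiece x F d).map h).map (f + c • h') := by
      rw [← Submodule.map_smul (h' + c⁻¹ • f) _ c hc0, smul_add, smul_smul,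
        mul_inv_cancel₀ hc0, one_smul, add_comm]
    rw [hscale] at hc2
    rw [← LinearMap.comp_smul, ← LinearMap.comp_add, Submodule.map_comp (f + c • h')] at hc1
    have e := finrank_map_add_finrank_inf_ker ((gradedPiece x F (d + 1)).map (f + c • h')) g
    have hle : ((gradedPiece x F d).map h).map (f + c • h') ≤
        (gradedPiece x F (d + 1)).map (f + c • h') ⊓ LinearMap.ker g := by
      refine le_inf (Submodule.map_mono (map_gradedPiece_le hh d)) ?_
      rw [hg, Submodule.ker_mkQ]
      rintro _ ⟨_, ⟨v, hv, rfl⟩, rfl⟩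
      rw [show (f + c • h') (h v) = h ((f + c • h') v) from
        LinearMap.congr_fun (commute_of_mem_span hx hmem hh).eq v]
      exact Submodule.mem_map_of_mem (map_gradedPiece_le hmem d (Submodule.mem_map_of_mem hv))
    have := Submodule.finrank_mono hle
    have := hmax _ hmem
    omega

/-- If the Hilbert function grows maximally from `m + 2` to `m + 3` in degree `m` and there is no
socle in degree `m - 1`, then it takes the value `m + 1` in degree `m - 1`. -/
theorem finrank_gradedPiece_eq_of_infinite [Infinite k] [Finite ι] [FiniteDimensional k F]
    (hx : ∀ i j, Commute (x i) (x j)) (d : ℕ)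
    (hsoc : ∀ v ∈ gradedPiece x F (d + 1), (∀ i, x i v = 0) → v = 0)
    (h2 : Module.finrank k (gradedPiece x F (d + 2)) = d + 4)
    (h3 : Module.finrank k (gradedPiece x F (d + 3)) = d + 5) :
    Module.finrank k (gradedPiece x F (d + 1)) = d + 3 := by
  have hfin := fun j => finiteDimensional_gradedPiece (x := x) (F := F) j
  have hmem : ∀ i, x i ∈ Submodule.span k (Set.range x) :=
    fun i => Submodule.subset_span ⟨i, rfl⟩
  obtain ⟨h, hh, hr⟩ := exists_finrank_gradedPiece_le_finrank_map_add_one hx (d + 1) F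
    (by change Module.finrank k (gradedPiece x F (d + 2)) ≤ _; omega)
  change Module.finrank k (gradedPiece x F (d + 2)) ≤ _ at hr
  have hcomm : ∀ f ∈ Submodule.span k (Set.range x), ∀ v, f (h v) = h (f v) := fun f hf v =>
    LinearMap.congr_fun (commute_of_mem_span hx hf hh).eq v
  have hle1 : Module.finrank k ((gradedPiece x F (d + 3)).map
      ((gradedPiece x F (d + 2)).map h).mkQ) ≤ 1 := finrank_map_gradedPiece_le_one (F := F) hx
    ((gradedPiece x F (d + 2)).map h).mkQ (d + 1) (by
      intro f hf
      have e := finrank_map_add_finrank_inf_ker (gradedPiece x F (d + 2))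
        (((gradedPiece x F (d + 2)).map h).mkQ ∘ₗ f)
      have : (gradedPiece x F (d + 1)).map h ≤ gradedPiece x F (d + 2) ⊓
          LinearMap.ker (((gradedPiece x F (d + 2)).map h).mkQ ∘ₗ f) := by
        refine le_inf (map_gradedPiece_le hh _) ?_
        rintro _ ⟨v, hv, rfl⟩
        rw [LinearMap.mem_ker, LinearMap.comp_apply, Submodule.mkQ_apply,
          Submodule.Quotient.mk_eq_zero, hcomm f hf]
        exact Submodule.mem_map_of_mem (map_gradedPiece_le hf _ (Submodule.mem_map_of_mem hv))
      have := Submodule.finrank_mono this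
      change Module.finrank k ((gradedPiece x F (d + 2)).map _) ≤ 1
      omega)
  have hker : Module.finrank k ((gradedPiece x F (d + 2)).map h) = d + 4 := by
    have e := finrank_map_add_finrank_inf_ker (gradedPiece x F (d + 3))
        ((gradedPiece x F (d + 2)).map h).mkQ
    rw [Submodule.ker_mkQ, inf_eq_right.mpr (map_gradedPiece_le hh _)] at e
    have := Submodule.finrank_map_le h (gradedPiece x F (d + 2))
    omega
  have hinj2 : ∀ v ∈ gradedPiece x F (d + 2), h v = 0 → v = 0 := by
    intro v hv hv0
    have e := finrank_map_add_finrank_inf_ker (gradedPiece x F (d + 2)) h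
    have : Module.finrank k
      (gradedPiece x F (d + 2) ⊓ LinearMap.ker h : Submodule k M) = 0 := by omega
    rw [Submodule.finrank_eq_zero] at this
    exact (Submodule.mem_bot k).mp (this ▸ ⟨hv, hv0⟩)
  have hbot : gradedPiece x F (d + 1) ⊓ LinearMap.ker h = ⊥ := by
    rw [eq_bot_iff]
    rintro v ⟨hv, hv0⟩
    refine hsoc v hv fun i => hinj2 _
      (map_gradedPiece_le (hmem i) _ (Submodule.mem_map_of_mem hv)) ?_
    rw [← hcomm _ (hmem i), LinearMap.mem_ker.mp hv0, map_zero]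
  have e1 := finrank_map_add_finrank_inf_ker (gradedPiece x F (d + 1)) h
  rw [hbot, finrank_bot] at e1
  have hlt : Module.finrank k ((gradedPiece x F (d + 1)).map h) ≠ d + 4 := by
    intro heq
    have hEq := Submodule.eq_of_le_of_finrank_eq (map_gradedPiece_le (F := F) hh (d + 1))
      (heq.trans h2.symm)
    have : gradedPiece x F (d + 3) ≤ (gradedPiece x F (d + 2)).map h := by
      refine iSup_le fun i => ?_
      rw [← hEq]
      rintro _ ⟨_, ⟨v, hv, rfl⟩, rfl⟩
      rw [hcomm _ (hmem i)]
      refine Submodule.mem_map_of_mem ?_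
      rw [hEq]
      exact map_gradedPiece_le (hmem i) _ (Submodule.mem_map_of_mem hv)
    have := Submodule.finrank_mono this
    omega
  have : _ ≤ Module.finrank k (gradedPiece x F (d + 2)) :=
    Submodule.finrank_mono (map_gradedPiece_le (F := F) hh (d + 1))
  omega

open TensorProduct in
theorem baseChange_gradedPiece (K : Type*) [Field K] [Algebra k K] (d : ℕ) :
    gradedPiece (fun i => (x i).baseChange K) (F.baseChange K) d =
      (gradedPiece x F d).baseChange K := by
  induction d with
  | zero => rfl
  | succ d ih =>
    simp only [gradedPiece, ih]
    refine le_antisymm (iSup_le fun i => ?_) ?_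
    · rw [Submodule.baseChange_eq_span, Submodule.map_span, Submodule.span_le]
      rintro _ ⟨_, ⟨v, hv, rfl⟩, rfl⟩
      exact Submodule.tmul_mem_baseChange_of_mem (1 : K)
        (Submodule.mem_iSup_of_mem i (Submodule.mem_map_of_mem hv))
    · rw [Submodule.baseChange_eq_span, Submodule.span_le]
      rintro _ ⟨v, hv, rfl⟩
      induction hv using Submodule.iSup_induction' with
      | mem i v hv =>
        obtain ⟨w, hw, rfl⟩ := hv
        exact Submodule.mem_iSup_of_mem i
          ⟨1 ⊗ₜ w, Submodule.tmul_mem_baseChange_of_mem (1 : K) hw, rfl⟩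
      | zero => rw [map_zero]; exact zero_mem _
      | add v w _ _ hv hw => rw [map_add]; exact add_mem hv hw

theorem finrank_submodule_baseChange_s3 (K : Type*) [Field K] [Algebra k K] (N : Submodule k M) :
    Module.finrank K (N.baseChange K) = Module.finrank k N := by
  rw [Submodule.baseChange, LinearMap.finrank_range_of_inj, Module.finrank_baseChange]
  exact Module.Flat.lTensor_preserves_injective_linearMap _ N.injective_subtype

open TensorProduct in
theorem eq_zero_of_mem_baseChange_s3 [Finite ι] (K : Type*) [Field K] [Algebra k K]
    {N : Submodule k M} (hN : ∀ v ∈ N, (∀ i, x i v = 0) → v = 0) {v : K ⊗[k] M}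
    (hv : v ∈ N.baseChange K) (h0 : ∀ i, (x i).baseChange K v = 0) : v = 0 := by
  classical
  have := Fintype.ofFinite ι
  obtain ⟨y, rfl⟩ := hv
  let φ : N →ₗ[k] (ι → M) := LinearMap.pi fun i => x i ∘ₗ N.subtype
  have hφ : Function.Injective φ := by
    rw [injective_iff_map_eq_zero]
    exact fun w hw => Subtype.ext (hN w w.2 fun i => congrFun hw i)
  have hφK : Function.Injective (φ.baseChange K) :=
    Module.Flat.lTensor_preserves_injective_linearMap _ hφ
  have key : ∀ i, (LinearMap.proj i ∘ₗ (TensorProduct.piRight k K K fun _ : ι => M).toLinearMap) ∘ₗ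
      φ.baseChange K = (x i).baseChange K ∘ₗ N.subtype.baseChange K := by
    intro i
    ext w
    simp [φ]
  have hy : φ.baseChange K y = 0 := by
    apply (TensorProduct.piRight k K K fun _ : ι => M).injective
    rw [map_zero]
    funext i
    exact (LinearMap.congr_fun (key i) y).trans (h0 i)
  rw [hφK (hy.trans (map_zero _).symm), map_zero]

theorem finrank_gradedPiece_eq [Finite ι] [FiniteDimensional k F]
    (hx : ∀ i j, Commute (x i) (x j)) (d : ℕ)
    (hsoc : ∀ v ∈ gradedPiece x F (d + 1), (∀ i, x i v = 0) → v = 0)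
    (h2 : Module.finrank k (gradedPiece x F (d + 2)) = d + 4)
    (h3 : Module.finrank k (gradedPiece x F (d + 3)) = d + 5) :
    Module.finrank k (gradedPiece x F (d + 1)) = d + 3 := by
  let K := AlgebraicClosure k
  have : FiniteDimensional K (F.baseChange K) := by
    rw [Submodule.baseChange]; infer_instance
  have e : ∀ j, Module.finrank K (gradedPiece (fun i => (x i).baseChange K) (F.baseChange K) j) =
      Module.finrank k (gradedPiece x F j) := fun j => by
    rw [baseChange_gradedPiece, finrank_submodule_baseChange_s3]
  rw [← e] at h2 h3 ⊢
  refine finrank_gradedPiece_eq_of_infinite (fun i j => ?_) d (fun v hv h0 => ?_) h2 h3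
  · rw [commute_iff_eq, ← LinearMap.baseChange_mul, (hx i j).eq, LinearMap.baseChange_mul]
  · rw [baseChange_gradedPiece] at hv
    exact eq_zero_of_mem_baseChange_s3 K hsoc hv h0

end GradedPiece

theorem homogeneousSubmodule_succ_le {σ R : Type*} [CommSemiring R] (d : ℕ) :
    homogeneousSubmodule σ R (d + 1) ≤
      ⨆ i, (homogeneousSubmodule σ R d).map (LinearMap.mulLeft R (X i)) := by
  intro p hp
  rw [p.as_sum]
  refine sum_mem fun s hs => ?_
  have hdeg : s.degree = d + 1 := by
    rw [← hp (mem_support_iff.mp hs), Finsupp.degree_eq_weight_one]; rfl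
  obtain ⟨i, hi⟩ : ∃ i, s i ≠ 0 := by
    by_contra! h
    have : s = 0 := Finsupp.ext h
    simp [this] at hdeg
  have hle : Finsupp.single i 1 ≤ s := by
    rw [Finsupp.single_le_iff]; exact Nat.one_le_iff_ne_zero.mpr hi
  have hs' : Finsupp.single i 1 + (s - Finsupp.single i 1) = s := add_tsub_cancel_of_le hle
  refine Submodule.mem_iSup_of_mem i ⟨monomial (s - Finsupp.single i 1) (coeff s p), ?_, ?_⟩
  · refine isHomogeneous_monomial _ ?_
    have := congrArg Finsupp.degree hs'
    rw [map_add, Finsupp.degree_single, hdeg] at this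
    omega
  · rw [LinearMap.mulLeft_apply, X, monomial_mul, hs', one_mul]

section

variable {ι k : Type*} [Field k] (I : Ideal (MvPolynomial ι k))

theorem gradedPiece_quotient_eq (d : ℕ) :
    gradedPiece (fun i => LinearMap.mulLeft k (Ideal.Quotient.mkₐ k I (X i)))
      (Submodule.span k {1}) d =
      (homogeneousSubmodule ι k d).map (Ideal.Quotient.mkₐ k I).toLinearMap := by
  induction d with
  | zero =>
    rw [homogeneousSubmodule_zero, Submodule.one_eq_span, Submodule.map_span]
    simp [gradedPiece]
  | succ d ih =>
    simp only [gradedPiece, ih]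
    refine le_antisymm (iSup_le fun i => ?_) ?_
    · rintro _ ⟨_, ⟨p, hp, rfl⟩, rfl⟩
      refine ⟨X i * p, ?_, by simp⟩
      rw [add_comm]
      exact (isHomogeneous_X k i).mul hp
    · refine (Submodule.map_mono (homogeneousSubmodule_succ_le d)).trans ?_
      rw [Submodule.map_iSup]
      refine iSup_mono fun i => ?_
      rintro _ ⟨_, ⟨p, hp, rfl⟩, rfl⟩
      exact ⟨_, Submodule.mem_map_of_mem hp, by simp⟩

theorem gradedHilb_eq_finrank_gradedPiece (d : ℕ) :
    gradedHilb I d = Module.finrank k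
      (gradedPiece (fun i => LinearMap.mulLeft k (Ideal.Quotient.mkₐ k I (X i)))
        (Submodule.span k {1}) d) := by
  rw [gradedPiece_quotient_eq, ← LinearMap.range_domRestrict,
    ← (LinearMap.quotKerEquivRange _).finrank_eq, gradedHilb]
  have : Submodule.comap (homogeneousSubmodule ι k d).subtype (Submodule.restrictScalars k I) =
      LinearMap.ker ((Ideal.Quotient.mkₐ k I).toLinearMap.domRestrict
        (homogeneousSubmodule ι k d)) := by
    ext p
    exact Ideal.Quotient.eq_zero_iff_mem.symm
  rw [this]

end

/-- (Lemma 2.9(2)) Let `S = k[α₁,…,α_n]`, `I ⊆ S` a homogeneous ideal and `A = S/I`,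
with Hilbert function `H_A(m) = dim_k S_m/(I ∩ S_m)`.  Suppose `I` is `m`-saturated
for some `m ≥ 2`.  If `H_A(m) = m + 2` and `H_A(m+1) = m + 3`, then `H_A(l) = l + 2`
for all `1 ≤ l ≤ m`; in particular `H_A(1) = 3`. -/
theorem gradedHilb_eq_of_m_saturated_of_add_two {n : ℕ} {k : Type*} [Field k]
    (I : Ideal (MvPolynomial (Fin n) k))
    (hhom : ∀ p ∈ I, ∀ e : ℕ, homogeneousComponent e p ∈ I)
    (m : ℕ) (hm : 2 ≤ m)
    (hsat : ∀ l ≤ m, ∀ σ : MvPolynomial (Fin n) k, σ.IsHomogeneous l →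
      (∀ τ ∈ (Ideal.span (Set.range (X : Fin n → MvPolynomial (Fin n) k))) ^ (m - l),
        σ * τ ∈ I) → σ ∈ I)
    (hHm : gradedHilb I m = m + 2) (hHm1 : gradedHilb I (m + 1) = m + 3) :
    ∀ l, 1 ≤ l → l ≤ m → gradedHilb I l = l + 2 := by
  have key : ∀ l, l + 1 < m → gradedHilb I (l + 2) = l + 4 → gradedHilb I (l + 3) = l + 5 →
      gradedHilb I (l + 1) = l + 3 := by
    intro l hl h2 h3
    rw [gradedHilb_eq_finrank_gradedPiece] at h2 h3 ⊢
    refine finrank_gradedPiece_eq (fun i j => ?_) l (fun v hv h0 => ?_) h2 h3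
    · refine LinearMap.ext fun v => ?_
      exact mul_left_comm (Ideal.Quotient.mkₐ k I (X i)) (Ideal.Quotient.mkₐ k I (X j)) v
    · rw [gradedPiece_quotient_eq] at hv
      obtain ⟨σ, hσ, rfl⟩ := hv
      refine Ideal.Quotient.eq_zero_iff_mem.mpr (hsat (l + 1) hl.le σ hσ fun τ hτ => ?_)
      replace hτ := Ideal.pow_le_self (by omega) hτ
      induction hτ using Submodule.span_induction with
      | mem τ hτ =>
        obtain ⟨i, rfl⟩ := hτ
        rw [mul_comm]
        exact Ideal.Quotient.eq_zero_iff_mem.mp ((map_mul _ _ _).trans (h0 i))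
      | zero => simp
      | add a b _ _ ha hb => rw [mul_add]; exact add_mem ha hb
      | smul c a _ ha => rw [smul_eq_mul, mul_left_comm]; exact I.mul_mem_left c ha
  have desc : ∀ j l, 1 ≤ l → l + j = m →
      gradedHilb I l = l + 2 ∧ gradedHilb I (l + 1) = l + 3 := by
    intro j
    induction j with
    | zero => rintro l - rfl; exact ⟨hHm, hHm1⟩
    | succ j ih =>
      intro l hl hlj
      obtain ⟨l, rfl⟩ := Nat.exists_eq_add_of_le' hl
      obtain ⟨h2, h3⟩ := ih (l + 2) (by omega) (by omega)
      exact ⟨key l (by omega) h2 h3, h2⟩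
  exact fun l hl hlm => (desc (m - l) l hl (by omega)).1
end
end

section
/- Let A be a graded quotient of a polynomial ring over a field k. If H_A(l) ≤ l for some l ≥ 1, then the Hilbert function satisfies H_A(l) ≥ H_A(l+1) ≥ H_A(l+2) ≥ …, i.e., it is non-increasing from degree l on; in particular H_A(m) ≤ l for all m ≥ l. -/
open MvPolynomial

noncomputable section

/-- The dimension of the image of the subspace `V` in the quotient by the subspace `P`. -/
def relFinrank {k M : Type*} [Field k] [AddCommGroup M] [Module k M] (V P : Submodule k M) : ℕ :=
  Module.finrank k (V.map P.mkQ)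

section relFinrank

variable {k M : Type*} [Field k] [AddCommGroup M] [Module k M]

theorem finrank_quotient_comap_subtype (V P : Submodule k M) :
    Module.finrank k (V ⧸ P.comap V.subtype) = relFinrank V P := by
  have hker : (P.mkQ ∘ₗ V.subtype).ker = P.comap V.subtype := by
    rw [LinearMap.ker_comp, Submodule.ker_mkQ]
  have hrange : (P.mkQ ∘ₗ V.subtype).range = V.map P.mkQ := by
    rw [LinearMap.range_comp, Submodule.range_subtype]
  rw [relFinrank, ← hrange, ← hker]
  exact (P.mkQ ∘ₗ V.subtype).quotKerEquivRange.finrank_eq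

theorem map_mkQ_eq_bot_iff {V P : Submodule k M} : V.map P.mkQ = ⊥ ↔ V ≤ P := by
  rw [← le_bot_iff, Submodule.map_le_iff_le_comap, Submodule.comap_bot, Submodule.ker_mkQ]

theorem relFinrank_eq_zero_of_le {V P : Submodule k M} (h : V ≤ P) : relFinrank V P = 0 := by
  rw [relFinrank, map_mkQ_eq_bot_iff.2 h, finrank_bot]

theorem relFinrank_eq_zero_iff {V P : Submodule k M} (hV : V.FG) :
    relFinrank V P = 0 ↔ V ≤ P := by
  refine ⟨fun h => ?_, relFinrank_eq_zero_of_le⟩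
  have : Module.Finite k (V.map P.mkQ) := Module.Finite.iff_fg.2 (hV.map _)
  rw [relFinrank, Submodule.finrank_eq_zero, map_mkQ_eq_bot_iff] at h
  exact h

theorem relFinrank_anti_right {V P Q : Submodule k M} (hV : V.FG) (h : P ≤ Q) :
    relFinrank V Q ≤ relFinrank V P := by
  have : Module.Finite k (V.map P.mkQ) := Module.Finite.iff_fg.2 (hV.map _)
  rw [relFinrank, relFinrank, ← Submodule.factor_comp_mk h, Submodule.map_comp]
  exact Submodule.finrank_map_le _ _

theorem relFinrank_map (f : M →ₗ[k] M) (V P : Submodule k M) :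
    relFinrank (V.map f) P = relFinrank V (P.comap f) := by
  have hinj : Function.Injective ((P.comap f).mapQ P f le_rfl) := by
    rw [← LinearMap.ker_eq_bot]
    exact Submodule.ker_liftQ_eq_bot' _ _ (by rw [LinearMap.ker_comp, Submodule.ker_mkQ])
  have : (V.map f).map P.mkQ =
      (V.map (P.comap f).mkQ).map ((P.comap f).mapQ P f le_rfl) := by
    rw [← Submodule.map_comp, ← Submodule.map_comp, Submodule.mapQ_mkQ]
  rw [relFinrank, this]
  exact (Submodule.equivMapOfInjective _ hinj _).finrank_eq.symm

theorem relFinrank_sup {V Y : Submodule k M} (P : Submodule k M) (hV : V.FG) (hY : Y.FG) :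
    relFinrank (V ⊔ Y) P = relFinrank V (Y ⊔ P) + relFinrank Y P := by
  have : Module.Finite k ((V ⊔ Y).map P.mkQ) := Module.Finite.iff_fg.2 ((hV.sup hY).map _)
  set T := (V ⊔ Y).map P.mkQ
  have hle : Y.map P.mkQ ≤ T := Submodule.map_mono le_sup_right
  set g := Submodule.factor (le_sup_right : P ≤ Y ⊔ P)
  have hg : g ∘ₗ P.mkQ = (Y ⊔ P).mkQ := Submodule.factor_comp_mk _
  have hrange : (g ∘ₗ T.subtype).range = V.map (Y ⊔ P).mkQ := by
    rw [LinearMap.range_comp, Submodule.range_subtype, ← Submodule.map_comp, hg, Submodule.map_sup,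
      sup_eq_left]
    rw [map_mkQ_eq_bot_iff.2 le_sup_left]
    exact bot_le
  have hkerg : g.ker = Y.map P.mkQ := by
    have h : g.ker.comap P.mkQ = (Y.map P.mkQ).comap P.mkQ := by
      rw [← LinearMap.ker_comp, hg, Submodule.ker_mkQ, Submodule.comap_map_mkQ, sup_comm]
    exact Submodule.comap_injective_of_surjective P.mkQ_surjective h
  have hker : Module.finrank k (g ∘ₗ T.subtype).ker = relFinrank Y P := by
    rw [LinearMap.ker_comp, hkerg]
    exact (Submodule.comapSubtypeEquivOfLe hle).finrank_eq
  have := (g ∘ₗ T.subtype).finrank_range_add_finrank_ker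
  rw [hrange, hker] at this
  exact this.symm

end relFinrank

section Growth

variable {k R : Type*} [Field k] [CommRing R] [Algebra k R]

theorem span_singleton_mul_eq_map_mulLeft (a : R) (N : Submodule k R) :
    Submodule.span k {a} * N = N.map (LinearMap.mulLeft k a) := by
  ext x
  simp [Submodule.mem_span_singleton_mul]

theorem sup_pow_succ (L U : Submodule k R) (d : ℕ) :
    (L ⊔ U) ^ (d + 1) = U ^ (d + 1) ⊔ L * (L ⊔ U) ^ d := by
  induction d with
  | zero => simp [sup_comm]
  | succ d ih =>
    apply le_antisymm
    · rw [pow_succ' _ (d + 1), Submodule.sup_mul]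
      refine sup_le le_sup_right ?_
      conv_lhs => rw [ih]
      rw [Submodule.mul_sup, ← pow_succ']
      refine sup_le le_sup_left (le_trans ?_ le_sup_right)
      rw [mul_left_comm]
      refine mul_le_mul_right ?_ _
      rw [pow_succ']
      exact mul_le_mul_left le_sup_right _
    · refine sup_le (pow_le_pow_left' le_sup_right _) ?_
      rw [pow_succ' _ (d + 1)]
      exact mul_le_mul_left le_sup_left _

theorem relFinrank_pow_succ_eq_zero {W : Submodule k R} (hW : W.FG) {P : ℕ → Submodule k R}
    (hP : ∀ d, W * P d ≤ P (d + 1)) {d : ℕ} (h : relFinrank (W ^ d) (P d) = 0) :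
    relFinrank (W ^ (d + 1)) (P (d + 1)) = 0 := by
  rw [relFinrank_eq_zero_iff (hW.pow d)] at h
  refine relFinrank_eq_zero_of_le ?_
  rw [pow_succ']
  exact (mul_le_mul_right h _).trans (hP d)

/-- If `P` is stable under multiplication by a finite-dimensional space `W` of forms of degree one
and the image of `W ^ d` modulo `P d` has dimension at most `d`, then the dimension does not grow
in the next degree. -/
theorem relFinrank_pow_succ_le (s : Finset R) (P : ℕ → Submodule k R)
    (hP : ∀ d, Submodule.span k s * P d ≤ P (d + 1)) (d : ℕ)
    (h : relFinrank (Submodule.span k (s : Set R) ^ d) (P d) ≤ d) :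
    relFinrank (Submodule.span k (s : Set R) ^ (d + 1)) (P (d + 1)) ≤
      relFinrank (Submodule.span k (s : Set R) ^ d) (P d) := by
  classical
  induction s using Finset.induction_on generalizing P d with
  | empty =>
    refine (relFinrank_eq_zero_of_le ?_).trans_le (Nat.zero_le _)
    simp
  | insert a s _ ihs =>
    induction d generalizing P with
    | zero =>
      rw [relFinrank_pow_succ_eq_zero (Submodule.fg_span (Finset.finite_toSet _)) hP
        (Nat.le_zero.1 h)]
      exact Nat.zero_le _
    | succ d ihd =>
      rw [Finset.coe_insert, Submodule.span_insert] at *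
      set L := Submodule.span k {a}
      set U := Submodule.span k (s : Set R)
      have hL : L.FG := Submodule.fg_span (Set.finite_singleton a)
      have hU : U.FG := Submodule.fg_span s.finite_toSet
      have hW : (L ⊔ U).FG := hL.sup hU
      let Q : ℕ → Submodule k R := fun e => (P (e + 1)).comap (LinearMap.mulLeft k a)
      have hLQ (e : ℕ) (N : Submodule k R) : N ≤ Q e ↔ L * N ≤ P (e + 1) := by
        rw [span_singleton_mul_eq_map_mulLeft, Submodule.map_le_iff_le_comap]
      have hQ (e : ℕ) : (L ⊔ U) * Q e ≤ Q (e + 1) := by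
        rw [hLQ, mul_left_comm]
        exact (mul_le_mul_right ((hLQ e _).1 le_rfl) _).trans (hP _)
      have hPQ (e : ℕ) : P e ≤ Q e :=
        (hLQ e _).2 ((mul_le_mul_left le_sup_left _).trans (hP e))
      let P' : ℕ → Submodule k R
        | 0 => P 0
        | e + 1 => L * (L ⊔ U) ^ e ⊔ P (e + 1)
      have hUP (e : ℕ) : U * P e ≤ P (e + 1) :=
        (mul_le_mul_left le_sup_right _).trans (hP e)
      have hP' (e : ℕ) : U * P' e ≤ P' (e + 1) := by
        cases e with
        | zero => exact (hUP 0).trans le_sup_right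
        | succ e =>
          change U * (L * (L ⊔ U) ^ e ⊔ P (e + 1)) ≤ L * (L ⊔ U) ^ (e + 1) ⊔ P (e + 2)
          rw [Submodule.mul_sup, mul_left_comm, pow_succ']
          exact sup_le_sup (mul_le_mul_right (mul_le_mul_left le_sup_right _) _)
            (hUP _)
      have hrec (e : ℕ) : relFinrank ((L ⊔ U) ^ (e + 1)) (P (e + 1)) =
          relFinrank (U ^ (e + 1)) (P' (e + 1)) + relFinrank ((L ⊔ U) ^ e) (Q e) := by
        rw [sup_pow_succ, relFinrank_sup _ (hU.pow _) (hL.mul (hW.pow _))]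
        congr 1
        rw [span_singleton_mul_eq_map_mulLeft, relFinrank_map]
      by_cases h0 : relFinrank (U ^ (d + 1)) (P' (d + 1)) = 0
      · rw [hrec (d + 1), relFinrank_pow_succ_eq_zero hU hP' h0, zero_add]
        exact relFinrank_anti_right (hW.pow _) (hPQ _)
      · have hd := hrec d
        have h1 := ihs P' hP' (d + 1) (by omega)
        have h2 := ihd Q hQ (by omega)
        rw [hrec (d + 1), hd]
        exact add_le_add h1 h2

end Growth

theorem gradedHilb_eq_relFinrank {ι k : Type*} [Field k] (I : Ideal (MvPolynomial ι k)) (m : ℕ) :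
    gradedHilb I m = relFinrank (Submodule.span k (Set.range X) ^ m) (I.restrictScalars k) := by
  rw [gradedHilb, finrank_quotient_comap_subtype, ← homogeneousSubmodule_one_eq_span_X,
    homogeneousSubmodule_one_pow]

/-- One step of the growth bound; the ideal need not be homogeneous. -/
theorem gradedHilb_succ_le {ι k : Type*} [Finite ι] [Field k] (I : Ideal (MvPolynomial ι k))
    {m : ℕ} (h : gradedHilb I m ≤ m) : gradedHilb I (m + 1) ≤ gradedHilb I m := by
  obtain ⟨s, hs⟩ := (Set.finite_range (X : ι → MvPolynomial ι k)).exists_finset_coe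
  simp only [gradedHilb_eq_relFinrank, ← hs] at h ⊢
  refine relFinrank_pow_succ_le _ (fun _ => I.restrictScalars k) (fun _ => ?_) m h
  exact Submodule.mul_le.2 fun a _ b hb => I.mul_mem_left a hb

/-- (Remark 2.8, a consequence of Macaulay's Growth Theorem) Let `A = S/I` be a graded
quotient of a polynomial ring over a field `k`, with Hilbert function
`H_A(m) = dim_k S_m/(I ∩ S_m)`.  If `H_A(l) ≤ l` for some `l ≥ 1`, then the Hilbert
function is non-increasing from degree `l` on; in particular `H_A(m) ≤ l` for all
`m ≥ l`. -/
theorem gradedHilb_antitone_of_le {n : ℕ} {k : Type*} [Field k]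
    (I : Ideal (MvPolynomial (Fin n) k))
    (hhom : ∀ p ∈ I, ∀ e : ℕ, homogeneousComponent e p ∈ I)
    (l : ℕ) (hl : 1 ≤ l) (h : gradedHilb I l ≤ l) :
    (∀ m, l ≤ m → gradedHilb I (m + 1) ≤ gradedHilb I m) ∧
    (∀ m, l ≤ m → gradedHilb I m ≤ l) := by
  have key (m : ℕ) (hm : l ≤ m) : gradedHilb I m ≤ l := by
    induction m, hm using Nat.le_induction with
    | base => exact h
    | succ m hm ih => exact (gradedHilb_succ_le I (ih.trans hm)).trans ih
  exact ⟨fun m hm => gradedHilb_succ_le I ((key m hm).trans hm), key⟩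
end
end

section
/- Let k be an algebraically closed field of characteristic neither 2 nor 3 and let A be a local Artin Gorenstein k-algebra with residue field k, of dimension dim_k A ≤ 14. If 4 ≤ H_A(1) ≤ 5, then H_A(2) ≤ 5. -/
open MvPolynomial

noncomputable section

/-- The Hilbert function `H(l) = dim_k 𝔪^l/𝔪^(l+1)` of a local algebra `(A, 𝔪)`. -/
noncomputable def hilb (k : Type*) [CommRing k] {A : Type*} [CommRing A] [Algebra k A]
    (M : Ideal A) (l : ℕ) : ℕ :=
  Module.finrank k
    (↥(Submodule.restrictScalars k (M ^ l)) ⧸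
      (Submodule.comap (Submodule.restrictScalars k (M ^ l)).subtype
        (Submodule.restrictScalars k (M ^ (l + 1)))))

section HilbertFunction

variable {k : Type*} [Field k] {A : Type*} [CommRing A] [Algebra k A]

theorem hilb_add_finrank_pow_succ [Module.Finite k A] (M : Ideal A) (l : ℕ) :
    hilb k M l + Module.finrank k (Submodule.restrictScalars k (M ^ (l + 1))) =
      Module.finrank k (Submodule.restrictScalars k (M ^ l)) := by
  have hle : Submodule.restrictScalars k (M ^ (l + 1)) ≤ Submodule.restrictScalars k (M ^ l) :=
    fun _ hx => Ideal.pow_le_pow_right l.le_succ hx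
  rw [← (Submodule.comapSubtypeEquivOfLe hle).finrank_eq]
  exact Submodule.finrank_quotient_add_finrank _

variable (k) in
/-- The annihilator of an ideal, as a `k`-subspace. -/
def annihilatorSubspace (I : Ideal A) : Submodule k A :=
  ⨅ x ∈ I, LinearMap.ker (LinearMap.mulLeft k x)

theorem mem_annihilatorSubspace {I : Ideal A} {a : A} :
    a ∈ annihilatorSubspace k I ↔ ∀ x ∈ I, x * a = 0 := by
  simp [annihilatorSubspace, Submodule.mem_iInf]

theorem exists_mem_socle_of_ne_bot [IsLocalRing A] [IsArtinianRing A] {I : Ideal A}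
    (hI : I ≠ ⊥) :
    ∃ a ∈ I, a ≠ 0 ∧ a ∈ annihilatorSubspace k (IsLocalRing.maximalIdeal A) := by
  classical
  have hnil : ∃ n, IsLocalRing.maximalIdeal A ^ n * I = ⊥ := by
    obtain ⟨n, hn⟩ := IsArtinianRing.isNilpotent_jacobson_bot (R := A)
    rw [IsLocalRing.jacobson_eq_maximalIdeal ⊥ bot_ne_top] at hn
    exact ⟨n, by rw [hn]; simp⟩
  obtain ⟨n, hn, hmin⟩ : ∃ n, IsLocalRing.maximalIdeal A ^ n * I = ⊥ ∧
      ∀ m < n, IsLocalRing.maximalIdeal A ^ m * I ≠ ⊥ :=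
    ⟨Nat.find hnil, Nat.find_spec hnil, fun _ hm => Nat.find_min hnil hm⟩
  cases n with
  | zero => simp [hI] at hn
  | succ n =>
    obtain ⟨a, ha, ha0⟩ := Submodule.exists_mem_ne_zero_of_ne_bot (hmin n n.lt_succ_self)
    refine ⟨a, Ideal.mul_le_right ha, ha0, mem_annihilatorSubspace.2 fun x hx => ?_⟩
    have := Ideal.mul_mem_mul hx ha
    rwa [← mul_assoc, ← pow_succ', hn, Ideal.mem_bot] at this

theorem socle_le_of_ne_bot [IsLocalRing A] [IsArtinianRing A]
    (hsoc : Module.finrank k (annihilatorSubspace k (IsLocalRing.maximalIdeal A)) = 1)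
    {I : Ideal A} (hI : I ≠ ⊥) :
    annihilatorSubspace k (IsLocalRing.maximalIdeal A) ≤ Submodule.restrictScalars k I := by
  obtain ⟨a, haI, ha0, ha⟩ := exists_mem_socle_of_ne_bot (k := k) hI
  intro b hb
  obtain ⟨c, hc⟩ := (finrank_eq_one_iff_of_nonzero' (⟨a, ha⟩ : annihilatorSubspace k
    (IsLocalRing.maximalIdeal A)) (by simpa [Subtype.ext_iff] using ha0)).1 hsoc ⟨b, hb⟩
  have hcb : c • a = b := congrArg Subtype.val hc
  exact hcb ▸ Submodule.smul_mem (Submodule.restrictScalars k I) c haI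

theorem exists_dual_ideal_eq_bot [IsLocalRing A] [IsArtinianRing A]
    (hsoc : Module.finrank k (annihilatorSubspace k (IsLocalRing.maximalIdeal A)) = 1) :
    ∃ φ : A →ₗ[k] k, ∀ I : Ideal A, (∀ a ∈ I, φ a = 0) → I = ⊥ := by
  obtain ⟨s, hs, hs0⟩ := Submodule.exists_mem_ne_zero_of_ne_bot
    (p := annihilatorSubspace k (IsLocalRing.maximalIdeal A)) (by
      intro h
      rw [h, finrank_bot] at hsoc
      exact zero_ne_one hsoc)
  obtain ⟨φ, hφ⟩ : ∃ φ : Module.Dual k A, φ s ≠ 0 := by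
    by_contra! h
    exact hs0 ((Module.forall_dual_apply_eq_zero_iff k s).1 h)
  refine ⟨φ, fun I hI => by_contra fun hne => hφ (hI s (socle_le_of_ne_bot hsoc hne hs))⟩

/-- The codimension in `𝔪` of the elements of `𝔪` killing a nonzero ideal `I` is less than
`dim I`: these classes embed in the functionals on `I` that vanish on the socle. -/
theorem finrank_maximalIdeal_lt_add [IsLocalRing A] [Module.Finite k A]
    (hsoc : Module.finrank k (annihilatorSubspace k (IsLocalRing.maximalIdeal A)) = 1)
    {I : Ideal A} (hI : I ≠ ⊥) :
    Module.finrank k (Submodule.restrictScalars k (IsLocalRing.maximalIdeal A)) <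
      Module.finrank k (Submodule.restrictScalars k I) +
        Module.finrank k (↥(Submodule.restrictScalars k (IsLocalRing.maximalIdeal A) ⊓
          annihilatorSubspace k I)) := by
  have : IsArtinianRing A := IsArtinianRing.of_finite k A
  obtain ⟨φ, hφ⟩ := exists_dual_ideal_eq_bot hsoc
  set m := Submodule.restrictScalars k (IsLocalRing.maximalIdeal A)
  set IK := Submodule.restrictScalars k I
  let f : m →ₗ[k] Module.Dual k IK :=
    ((LinearMap.mul k A).compr₂ φ).domRestrict₁₂ m IK
  have hf (a : m) (b : IK) : f a b = φ (a * b) := rfl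
  have hker : LinearMap.ker f ≤ (m ⊓ annihilatorSubspace k I).comap m.subtype := by
    intro a ha
    refine ⟨a.2, mem_annihilatorSubspace.2 fun x hx => ?_⟩
    have hbot : Ideal.span {(a : A)} * I = ⊥ := by
      refine hφ _ fun y hy => ?_
      obtain ⟨z, hz, rfl⟩ := Ideal.mem_span_singleton_mul.1 hy
      exact (hf a ⟨z, hz⟩).symm.trans (by rw [LinearMap.mem_ker.1 ha]; rfl)
    have := Ideal.mul_mem_mul (Ideal.mem_span_singleton_self (a : A)) hx
    rw [hbot, Ideal.mem_bot] at this
    rw [mul_comm]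
    exact this
  have hrange : Module.finrank k (LinearMap.range f) < Module.finrank k IK := by
    rw [← Subspace.dual_finrank_eq (K := k) (V := IK)]
    refine Submodule.finrank_lt fun htop => ?_
    obtain ⟨s, hsI, hs0, hs⟩ := exists_mem_socle_of_ne_bot (k := k) hI
    have hzero : (⟨s, hsI⟩ : IK) = 0 := by
      refine (Module.forall_dual_apply_eq_zero_iff k _).1 fun g => ?_
      obtain ⟨a, rfl⟩ := LinearMap.range_eq_top.1 htop g
      rw [hf]
      simp [mem_annihilatorSubspace.1 hs a a.2]
    exact hs0 (congrArg Subtype.val hzero)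
  have h1 := LinearMap.finrank_range_add_finrank_ker f
  have h2 := Submodule.finrank_mono hker
  rw [(Submodule.comapSubtypeEquivOfLe (inf_le_left : m ⊓ annihilatorSubspace k I ≤ m)).finrank_eq]
    at h2
  omega

/-- The annihilator of `M ^ 2` embeds, modulo the socle, in the linear maps from `M / M ^ 2` to
the socle. -/
theorem finrank_annihilatorSubspace_sq_le [Module.Finite k A] (M : Ideal A)
    (hsoc : Module.finrank k (annihilatorSubspace k M) = 1) :
    Module.finrank k (annihilatorSubspace k (M ^ 2)) ≤ 1 + hilb k M 1 := by
  let K := annihilatorSubspace k (M ^ 2)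
  let S := annihilatorSubspace k M
  let P := Submodule.restrictScalars k (M ^ 1)
  let Q := Submodule.restrictScalars k (M ^ (1 + 1))
  have hKP (x : K) (y : P) : (x : A) * y ∈ S := by
    refine mem_annihilatorSubspace.2 fun z hz => ?_
    have hy : (y : A) ∈ M := by simpa [P] using y.2
    have := mem_annihilatorSubspace.1 x.2 (z * y) (by rw [pow_two]; exact Ideal.mul_mem_mul hz hy)
    rw [← this]; ring
  let f : K →ₗ[k] (P ⧸ Q.comap P.subtype) →ₗ[k] S :=
    { toFun := fun x => (Q.comap P.subtype).liftQ
        (((LinearMap.mulLeft k (x : A)).comp P.subtype).codRestrict S (hKP x)) (by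
          intro y hy
          refine Subtype.ext ?_
          exact (mul_comm _ _).trans (mem_annihilatorSubspace.1 x.2 y hy))
      map_add' := fun x y => by
        ext z
        exact add_mul _ _ _
      map_smul' := fun c x => by
        ext z
        exact smul_mul_assoc _ _ _ }
  have hker : LinearMap.ker f ≤ S.comap K.subtype := by
    intro x hx
    refine mem_annihilatorSubspace.2 fun z hz => ?_
    have := congrArg Subtype.val (LinearMap.congr_fun (LinearMap.mem_ker.1 hx)
      (Submodule.Quotient.mk ⟨z, by simpa [P] using hz⟩))
    exact (mul_comm _ _).trans this
  have h1 := LinearMap.finrank_range_add_finrank_ker (K := k) (V := K)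
    (V₂ := (P ⧸ Q.comap P.subtype) →ₗ[k] S) f
  have h2 := Submodule.finrank_mono hker
  have h3 := Submodule.finrank_le (LinearMap.range f)
  have hSK : S ≤ K := fun x hx => mem_annihilatorSubspace.2 fun z hz =>
    mem_annihilatorSubspace.1 hx z (Ideal.pow_le_self two_ne_zero hz)
  rw [(Submodule.comapSubtypeEquivOfLe hSK).finrank_eq] at h2
  have h4 : Module.finrank k ((P ⧸ Q.comap P.subtype) →ₗ[k] S) = hilb k M 1 := by
    rw [Module.finrank_linearMap, hsoc, mul_one]
    rfl
  change Module.finrank k S = 1 at hsoc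
  change Module.finrank k K ≤ _
  omega

/-- If `N ⊆ M` has codimension `r` and `M N ⊆ K`, then `M ^ 2` is spanned modulo `K` by the
`r (r + 1) / 2` products of elements of a basis of a complement of `N` in `M`. -/
theorem finrank_sq_le_choose_add [Module.Finite k A] (M : Ideal A) (N K : Submodule k A) (r : ℕ)
    (hr : Module.finrank k (Submodule.restrictScalars k M) ≤ r + Module.finrank k N)
    (hNM : N ≤ Submodule.restrictScalars k M)
    (hK : ∀ x ∈ M, ∀ y ∈ N, x * y ∈ K) :
    Module.finrank k (Submodule.restrictScalars k (M ^ 2)) ≤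
      (r + 1).choose 2 + Module.finrank k K := by
  obtain ⟨C, hC⟩ := exists_isCompl N
  let D := C ⊓ Submodule.restrictScalars k M
  have hsup : N ⊔ D = Submodule.restrictScalars k M := by
    rw [← sup_inf_assoc_of_le C hNM, hC.sup_eq_top, top_inf_eq]
  have hinf : N ⊓ D = ⊥ := by
    rw [← inf_assoc, hC.inf_eq_bot, bot_inf_eq]
  have hD : Module.finrank k D ≤ r := by
    have := Submodule.finrank_sup_add_finrank_inf_eq N D
    rw [hsup, hinf, finrank_bot] at this
    omega
  let e := Module.finBasis k D
  let p : Sym2 (Fin (Module.finrank k D)) → A :=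
    Sym2.lift ⟨fun i j => (e i : A) * e j, fun _ _ => mul_comm _ _⟩
  let E := Submodule.span k (Set.range p)
  have hE : Module.finrank k E ≤ (r + 1).choose 2 := by
    refine (finrank_range_le_card p).trans ?_
    rw [Sym2.card, Fintype.card_fin]
    exact Nat.choose_le_choose 2 (Nat.succ_le_succ hD)
  have hDM : D ≤ Submodule.restrictScalars k M := inf_le_right
  have hDD (x y : D) : (x : A) * y ∈ E := by
    rw [← e.sum_repr x, ← e.sum_repr y]
    simp only [Submodule.coe_sum, Submodule.coe_smul, Finset.sum_mul_sum, smul_mul_smul_comm]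
    exact Submodule.sum_mem _ fun i _ => Submodule.sum_mem _ fun j _ =>
      Submodule.smul_mem _ _ (Submodule.subset_span ⟨s(i, j), rfl⟩)
  have hMM : Submodule.restrictScalars k (M ^ 2) ≤ E ⊔ K := by
    intro z hz
    rw [Submodule.restrictScalars_mem, pow_two] at hz
    refine Submodule.mul_induction_on hz (fun x hx y hy => ?_) fun x y hx hy => add_mem hx hy
    obtain ⟨n, hn, c, hc, rfl⟩ := Submodule.mem_sup.1 (hsup.ge hx)
    obtain ⟨n', hn', c', hc', rfl⟩ := Submodule.mem_sup.1 (hsup.ge hy)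
    have h1 : (n' + c') * n ∈ K := hK _ hy _ hn
    have h2 : c * n' ∈ K := hK _ (hDM hc) _ hn'
    have h3 : c * c' ∈ E := hDD ⟨c, hc⟩ ⟨c', hc'⟩
    have : (n + c) * (n' + c') = c * c' + ((n' + c') * n + c * n') := by ring
    rw [this]
    exact Submodule.add_mem_sup h3 (add_mem h1 h2)
  have h1 := Submodule.finrank_mono hMM
  have h2 := Submodule.finrank_add_le_finrank_add_finrank E K
  omega

/-- In a local Gorenstein algebra with `d = dim 𝔪 ^ 3 > 0`, the dimension of `𝔪 ^ 2` is at most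
`1 + H(1) + d (d - 1) / 2`. -/
theorem finrank_maximalIdeal_sq_le [IsLocalRing A] [Module.Finite k A]
    (hsoc : Module.finrank k (annihilatorSubspace k (IsLocalRing.maximalIdeal A)) = 1)
    (hne : IsLocalRing.maximalIdeal A ^ 3 ≠ ⊥) :
    Module.finrank k (Submodule.restrictScalars k (IsLocalRing.maximalIdeal A ^ 2)) ≤
      (Module.finrank k (Submodule.restrictScalars k (IsLocalRing.maximalIdeal A ^ 3))).choose 2 +
        (1 + hilb k (IsLocalRing.maximalIdeal A) 1) := by
  have hlt := finrank_maximalIdeal_lt_add hsoc hne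
  have hK := finrank_annihilatorSubspace_sq_le (IsLocalRing.maximalIdeal A) hsoc
  have hpos : 0 < Module.finrank k
      (Submodule.restrictScalars k (IsLocalRing.maximalIdeal A ^ 3)) := by
    have := Submodule.finrank_mono (inf_le_left :
      Submodule.restrictScalars k (IsLocalRing.maximalIdeal A) ⊓
        annihilatorSubspace k (IsLocalRing.maximalIdeal A ^ 3) ≤ _)
    omega
  obtain ⟨r, hr⟩ := Nat.exists_eq_add_of_lt hpos
  have hsq := finrank_sq_le_choose_add (IsLocalRing.maximalIdeal A)
    (Submodule.restrictScalars k (IsLocalRing.maximalIdeal A) ⊓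
      annihilatorSubspace k (IsLocalRing.maximalIdeal A ^ 3))
    (annihilatorSubspace k (IsLocalRing.maximalIdeal A ^ 2)) r (by omega) inf_le_left
    (fun x hx y hy => mem_annihilatorSubspace.2 fun z hz => by
      rw [← mul_assoc]
      refine mem_annihilatorSubspace.1 hy.2 (z * x) ?_
      rw [pow_succ]
      exact Ideal.mul_mem_mul hz hx)
  rw [hr, zero_add]
  omega

end HilbertFunction

/-- (Lemma 5.3) Let `k` be an algebraically closed field of characteristic neither two
nor three and `A` a local Artin Gorenstein `k`-algebra with residue field `k` of length
(`= dim_k A`) at most `14`.  If `4 ≤ H_A(1) ≤ 5` then `H_A(2) ≤ 5`, where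
`H_A(l) = dim_k 𝔪^l/𝔪^(l+1)`. -/
theorem hilb_two_le_five {k : Type*} [Field k] [IsAlgClosed k]
    (hchar2 : ringChar k ≠ 2) (hchar3 : ringChar k ≠ 3)
    (A : Type*) [CommRing A] [IsLocalRing A] [Algebra k A] [Module.Finite k A]
    (hres : Function.Bijective ((IsLocalRing.residue A).comp (algebraMap k A)))
    (hGor : Module.finrank k
      ↥(⨅ x ∈ IsLocalRing.maximalIdeal A, LinearMap.ker (LinearMap.mulLeft k x)) = 1)
    (hlen : Module.finrank k A ≤ 14)
    (h4 : 4 ≤ hilb k (IsLocalRing.maximalIdeal A) 1)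
    (h5 : hilb k (IsLocalRing.maximalIdeal A) 1 ≤ 5) :
    hilb k (IsLocalRing.maximalIdeal A) 2 ≤ 5 := by
  change Module.finrank k (annihilatorSubspace k (IsLocalRing.maximalIdeal A)) = 1 at hGor
  have e1 := hilb_add_finrank_pow_succ (k := k) (IsLocalRing.maximalIdeal A) 1
  have e2 := hilb_add_finrank_pow_succ (k := k) (IsLocalRing.maximalIdeal A) 2
  rw [one_add_one_eq_two, pow_one] at e1
  by_cases hne : IsLocalRing.maximalIdeal A ^ 3 = ⊥
  · have hle : Submodule.restrictScalars k (IsLocalRing.maximalIdeal A ^ 2) ≤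
        annihilatorSubspace k (IsLocalRing.maximalIdeal A) := fun x hx =>
      mem_annihilatorSubspace.2 fun z hz => by
        have := Ideal.mul_mem_mul hz hx
        rwa [← pow_succ', hne, Ideal.mem_bot] at this
    have := Submodule.finrank_mono hle
    omega
  · have hsq := finrank_maximalIdeal_sq_le hGor hne
    have hpos : Module.finrank k
        (Submodule.restrictScalars k (IsLocalRing.maximalIdeal A ^ 3)) ≠ 0 := fun h =>
      hne ((Submodule.restrictScalars_eq_bot_iff k A A).1 (Submodule.finrank_eq_zero.1 h))
    have hlt : Module.finrank k (Submodule.restrictScalars k (IsLocalRing.maximalIdeal A)) <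
        Module.finrank k A := by
      refine Submodule.finrank_lt fun h => ?_
      exact (IsLocalRing.maximalIdeal.isMaximal A).ne_top
        ((Submodule.restrictScalars_eq_top_iff k A A).1 h)
    by_contra! h6
    generalize Module.finrank k
      (Submodule.restrictScalars k (IsLocalRing.maximalIdeal A ^ 3)) = d at e2 hsq hpos
    have hd : d ≤ 3 := by omega
    interval_cases d <;> simp [Nat.choose] at hsq <;> omega
end
end
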